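/- Every E₀-congruence class of ground terms is finite. -/

import Mathlib

/-- Terms built from variables, free constants, two multiplication symbols
`mul` (*) and `cmul` (⊛), a binary symbol `exp`, and a unary symbol `g`. -/
inductive Tm : Type
  | var : ℕ → Tm
  | const : ℕ → Tm
  | mul : Tm → Tm → Tm
  | cmul : Tm → Tm → Tm
  | exp : Tm → Tm → Tm
  | g : Tm → Tm

/-- The equational theory E₀: the smallest congruence on terms, closed under
substitution (hence the axioms are stated for arbitrary terms), generated by
`exp(g(X),Y) = g(X ⊛ Y)` and `exp(X*Y,Z) = exp(X,Z) * exp(Y,Z)`. -/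
inductive E0 : Tm → Tm → Prop
  | ax1 (x y : Tm) : E0 (.exp (.g x) y) (.g (.cmul x y))
  | ax2 (x y z : Tm) : E0 (.exp (.mul x y) z) (.mul (.exp x z) (.exp y z))
  | refl (t : Tm) : E0 t t
  | symm {s t : Tm} : E0 s t → E0 t s
  | trans {s t u : Tm} : E0 s t → E0 t u → E0 s u
  | mul_congr {a b c d : Tm} : E0 a b → E0 c d → E0 (.mul a c) (.mul b d)
  | cmul_congr {a b c d : Tm} : E0 a b → E0 c d → E0 (.cmul a c) (.cmul b d)
  | exp_congr {a b c d : Tm} : E0 a b → E0 c d → E0 (.exp a c) (.exp b d)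
  | g_congr {a b : Tm} : E0 a b → E0 (.g a) (.g b)

/-- A ground term contains no variables. -/
def Tm.Ground : Tm → Prop
  | .var _ => False
  | .const _ => True
  | .mul s t => s.Ground ∧ t.Ground
  | .cmul s t => s.Ground ∧ t.Ground
  | .exp s t => s.Ground ∧ t.Ground
  | .g t => t.Ground

/-- A polynomial interpretation of terms that is invariant under `E0`. -/
def Tm.weight : Tm → ℕ
  | .var n => n + 1
  | .const n => n + 1
  | .mul s t => s.weight + t.weight
  | .cmul s t => s.weight * (t.weight + 1)
  | .exp s t => s.weight * (t.weight + 1)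
  | .g t => 2 * t.weight

theorem Tm.weight_pos (t : Tm) : 0 < t.weight := by
  induction t <;> simp only [Tm.weight] <;> positivity

theorem E0.weight_eq {s t : Tm} (h : E0 s t) : s.weight = t.weight := by
  induction h with
  | ax1 x y => simp only [Tm.weight]; ring
  | ax2 x y z => simp only [Tm.weight]; ring
  | refl => rfl
  | symm _ ih => exact ih.symm
  | trans _ _ ih₁ ih₂ => exact ih₁.trans ih₂
  | mul_congr _ _ ih₁ ih₂ => simp only [Tm.weight, ih₁, ih₂]
  | cmul_congr _ _ ih₁ ih₂ => simp only [Tm.weight, ih₁, ih₂]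
  | exp_congr _ _ ih₁ ih₂ => simp only [Tm.weight, ih₁, ih₂]
  | g_congr _ ih => simp only [Tm.weight, ih]

theorem Tm.finite_weight_le (n : ℕ) : {s : Tm | s.weight ≤ n}.Finite := by
  induction n with
  | zero =>
    refine Set.finite_empty.subset fun s hs => ?_
    exact absurd hs (not_le.mpr s.weight_pos)
  | succ n ih =>
    refine ((((((Set.finite_Iic n).image Tm.var).union ((Set.finite_Iic n).image Tm.const)).union
      (ih.image2 Tm.mul ih)).union (ih.image2 Tm.cmul ih)).union
      (ih.image2 Tm.exp ih)).union (ih.image Tm.g) |>.subset fun s hs => ?_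
    have hprod : ∀ a b : Tm, a.weight * (b.weight + 1) ≤ n + 1 →
        a.weight ≤ n ∧ b.weight ≤ n := fun a b h => by
      have ha := a.weight_pos
      have hb := b.weight_pos
      constructor <;> nlinarith
    simp only [Set.mem_union, Set.mem_image, Set.mem_image2, Set.mem_ofPred_eq, Set.mem_Iic]
      at hs ⊢
    cases s with
    | var k => simpa [Tm.weight] using hs
    | const k => simpa [Tm.weight] using hs
    | mul a b =>
      have ha := a.weight_pos
      have hb := b.weight_pos
      simp only [Tm.weight] at hs
      have hab : a.weight ≤ n ∧ b.weight ≤ n := by omega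
      simpa using hab
    | cmul a b => simpa using hprod a b hs
    | exp a b => simpa using hprod a b hs
    | g a =>
      have ha := a.weight_pos
      simp only [Tm.weight] at hs
      have hle : a.weight ≤ n := by omega
      simpa using hle

/-- Every E₀-congruence class of ground terms is finite. -/
theorem every_ground_E0_class_finite (t : Tm) (ht : t.Ground) :
    {s : Tm | s.Ground ∧ E0 s t}.Finite := by
  exact (Tm.finite_weight_le t.weight).subset fun _ hs => hs.2.weight_eq.le
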